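/- Let K be an algebraically closed field of characteristic ≠ 2,3 and λ ∈ K with λ³ + 27 ≠ 0. For all nonzero a, b ∈ K³ with f_λ(a) = 0 and f_λ(b) = 0, the adjugate matrix adj(M_{a,b}) ∈ Mat₃(K) has rank 1, and every nonzero vector c ∈ K³ with M_{a,b}·c = 0 again satisfies f_λ(c) = 0; that is, the point 𝔩(M_{a,b}) of ℙ² determined by the one-dimensional null space of M_{a,b} lies on the curve E = {f_λ = 0}. -/

import Mathlib

open MvPolynomial Matrix

/-- The Moore matrix `M_{a,y}`: (i,j) entry is `a_{i+j} · y_{i-j}`, indices in `ℤ/3ℤ`. -/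
noncomputable def moore {K : Type*} [CommRing K] (a : Fin 3 → K)
    (y : Fin 3 → MvPolynomial (Fin 3) K) :
    Matrix (Fin 3) (Fin 3) (MvPolynomial (Fin 3) K) :=
  Matrix.of fun i j => MvPolynomial.C (a (i + j)) * y (i - j)

/-- The specialized Moore matrix `M_{a,b} ∈ Mat₃(K)`. -/
def mooreK {K : Type*} [CommRing K] (a b : Fin 3 → K) : Matrix (Fin 3) (Fin 3) K :=
  Matrix.of fun i j => a (i + j) * b (i - j)

/-- The Hesse cubic `f_λ = x0³ + x1³ + x2³ + λ·x0x1x2`. -/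
noncomputable def hesse {K : Type*} [CommRing K] (l : K) : MvPolynomial (Fin 3) K :=
  X 0 ^ 3 + X 1 ^ 3 + X 2 ^ 3 + MvPolynomial.C l * (X 0 * X 1 * X 2)

/-- The doubling vector `b(a)`. -/
def dbl {K : Type*} [CommRing K] (a : Fin 3 → K) : Fin 3 → K :=
  ![a 0 * (a 2 ^ 3 - a 1 ^ 3), a 2 * (a 1 ^ 3 - a 0 ^ 3), a 1 * (a 0 ^ 3 - a 2 ^ 3)]

/-- The involution `ι(a0,a1,a2) = (a0,a2,a1)`. -/
def iot {K : Type*} [CommRing K] (a : Fin 3 → K) : Fin 3 → K := ![a 0, a 2, a 1]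

theorem eval_hesse {K : Type*} [CommRing K] (l : K) (c : Fin 3 → K) :
    eval c (hesse l) = c 0 ^ 3 + c 1 ^ 3 + c 2 ^ 3 + l * (c 0 * c 1 * c 2) := by
  simp [hesse]

theorem eq_zero_iff_fin_three {K : Type*} [Zero K] {v : Fin 3 → K} :
    v = 0 ↔ v 0 = 0 ∧ v 1 = 0 ∧ v 2 = 0 := by
  rw [funext_iff, Fin.forall_fin_succ, Fin.forall_fin_two]
  rfl

theorem iot_zero {K : Type*} [CommRing K] (a : Fin 3 → K) : iot a 0 = a 0 := rfl

theorem iot_one {K : Type*} [CommRing K] (a : Fin 3 → K) : iot a 1 = a 2 := rfl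

theorem iot_two {K : Type*} [CommRing K] (a : Fin 3 → K) : iot a 2 = a 1 := rfl

theorem iot_ne_zero {K : Type*} [CommRing K] {a : Fin 3 → K} (ha : a ≠ 0) : iot a ≠ 0 := by
  rw [Ne, eq_zero_iff_fin_three] at ha ⊢
  rw [iot_zero, iot_one, iot_two]
  tauto

theorem det_mooreK {K : Type*} [CommRing K] (a b : Fin 3 → K) :
    (mooreK a b).det = a 0 * a 1 * a 2 * (b 0 ^ 3 + b 1 ^ 3 + b 2 ^ 3) -
      (a 0 ^ 3 + a 1 ^ 3 + a 2 ^ 3) * (b 0 * b 1 * b 2) := by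
  have h21 : (2 : Fin 3) + 1 = 0 := rfl
  have h22 : (2 : Fin 3) + 2 = 1 := rfl
  have h12 : (1 : Fin 3) + 2 = 0 := rfl
  have h11 : (1 : Fin 3) + 1 = 2 := rfl
  have h1 : (-1 : Fin 3) = 2 := rfl
  have h2 : (-2 : Fin 3) = 1 := rfl
  have h3 : (1 : Fin 3) - 2 = 2 := rfl
  have h4 : (2 : Fin 3) - 1 = 1 := rfl
  simp only [mooreK, det_fin_three, of_apply, h21, h22, h12, h11, zero_sub, h1, h2, h3, h4,
    zero_add, add_zero, sub_zero, sub_self]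
  ring

theorem det_mooreK_of_eval_hesse_eq_zero {K : Type*} [CommRing K] {l : K} {a b : Fin 3 → K}
    (ha : eval a (hesse l) = 0) (hb : eval b (hesse l) = 0) : (mooreK a b).det = 0 := by
  rw [eval_hesse] at ha hb
  rw [det_mooreK]
  linear_combination a 0 * a 1 * a 2 * hb - b 0 * b 1 * b 2 * ha

theorem mooreK_mulVec_eq_zero_iff {K : Type*} [CommRing K] (a b c : Fin 3 → K) :
    mooreK a b *ᵥ c = 0 ↔
      a 0 * b 0 * c 0 + a 1 * b 2 * c 1 + a 2 * b 1 * c 2 = 0 ∧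
      a 1 * b 1 * c 0 + a 2 * b 0 * c 1 + a 0 * b 2 * c 2 = 0 ∧
      a 2 * b 2 * c 0 + a 0 * b 1 * c 1 + a 1 * b 0 * c 2 = 0 := by
  rw [funext_iff, Fin.forall_fin_succ, Fin.forall_fin_two]
  simp only [mulVec, dotProduct, Fin.sum_univ_three, Pi.zero_apply]
  exact Iff.rfl

/-- The tangent construction is well defined on a smooth Hesse cubic. -/
theorem dbl_ne_zero {K : Type*} [Field K] {l : K} (hl : l ^ 3 + 27 ≠ 0) {a : Fin 3 → K}
    (ha0 : a ≠ 0) (ha : eval a (hesse l) = 0) : dbl a ≠ 0 := by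
  intro h
  rw [eval_hesse] at ha
  have e0 : a 0 * (a 2 ^ 3 - a 1 ^ 3) = 0 := congrFun h 0
  have e1 : a 2 * (a 1 ^ 3 - a 0 ^ 3) = 0 := congrFun h 1
  have e2 : a 1 * (a 0 ^ 3 - a 2 ^ 3) = 0 := congrFun h 2
  have hz := eq_zero_iff_fin_three.not.1 ha0
  generalize a 0 = x, a 1 = y, a 2 = z at *
  by_cases hx : x = 0
  · subst hx
    simp at e1 e2
    grind
  by_cases hy : y = 0
  · subst hy
    simp at e0 e1
    grind
  by_cases hw : z = 0
  · subst hw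
    simp at e0 e2
    grind
  have f0 := (mul_eq_zero.1 e0).resolve_left hx
  have f1 := (mul_eq_zero.1 e1).resolve_left hw
  have key : l * (x * y * z) = -3 * x ^ 3 := by linear_combination ha - f0 - 2 * f1
  have hy3 : y ^ 3 = x ^ 3 := by linear_combination f1
  have hz3 : z ^ 3 = x ^ 3 := by linear_combination f0 + f1
  have : (l ^ 3 + 27) * x ^ 9 = 0 := by
    have := congrArg (· ^ 3) key
    simp only [mul_pow, hy3, hz3] at this
    linear_combination this
  simp_all

theorem adjugate_mooreK_ne_zero {K : Type*} [Field K] {a b : Fin 3 → K} (ha : dbl a ≠ 0)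
    (hb : b ≠ 0) : (mooreK a b).adjugate ≠ 0 := by
  intro h
  apply ha
  rw [adjugate_fin_three] at h
  have e (i j) := congrFun (congrFun h i) j
  obtain ⟨j, hj⟩ := Function.ne_iff.1 hb
  have h00 : a 2 * b 0 * (a 1 * b 0) - a 0 * b 2 * (a 0 * b 1) = 0 := e 0 0
  have h01 : -(a 1 * b 2 * (a 1 * b 0)) + a 2 * b 1 * (a 0 * b 1) = 0 := e 0 1
  have h02 : a 1 * b 2 * (a 0 * b 2) - a 2 * b 1 * (a 2 * b 0) = 0 := e 0 2
  have h10 : -(a 1 * b 1 * (a 1 * b 0)) + a 0 * b 2 * (a 2 * b 2) = 0 := e 1 0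
  have h11 : a 0 * b 0 * (a 1 * b 0) - a 2 * b 1 * (a 2 * b 2) = 0 := e 1 1
  have h12 : -(a 0 * b 0 * (a 0 * b 2)) + a 2 * b 1 * (a 1 * b 1) = 0 := e 1 2
  have h20 : a 1 * b 1 * (a 0 * b 1) - a 2 * b 0 * (a 2 * b 2) = 0 := e 2 0
  have h21 : -(a 0 * b 0 * (a 0 * b 1)) + a 1 * b 2 * (a 2 * b 2) = 0 := e 2 1
  have h22 : a 0 * b 0 * (a 2 * b 0) - a 1 * b 2 * (a 1 * b 1) = 0 := e 2 2
  have hb2 : b j ^ 2 ≠ 0 := pow_ne_zero 2 hj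
  have e0 : b j ^ 2 * (a 0 * (a 2 ^ 3 - a 1 ^ 3)) = 0 := by
    fin_cases j <;> grind
  have e1 : b j ^ 2 * (a 2 * (a 1 ^ 3 - a 0 ^ 3)) = 0 := by
    fin_cases j <;> grind
  have e2 : b j ^ 2 * (a 1 * (a 0 ^ 3 - a 2 ^ 3)) = 0 := by
    fin_cases j <;> grind
  simp [dbl, (mul_eq_zero.1 e0).resolve_left hb2, (mul_eq_zero.1 e1).resolve_left hb2,
    (mul_eq_zero.1 e2).resolve_left hb2]

theorem rank_adjugate_eq_one_of_fin_three {K : Type*} [Field K] {A : Matrix (Fin 3) (Fin 3) K}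
    (hA : A.det = 0) (h : A.adjugate ≠ 0) : A.adjugate.rank = 1 := by
  obtain ⟨i, j, hij⟩ : ∃ i j, A.adjugate i j ≠ 0 := by
    by_contra! h'
    exact h (ext h')
  have hsub : (A.submatrix j.succAbove i.succAbove).rank = 2 := by
    rw [adjugate_fin_succ_eq_det_submatrix] at hij
    simpa using rank_of_isUnit _
      ((isUnit_iff_isUnit_det _).2 (right_ne_zero_of_mul hij).isUnit)
  have hA2 := rank_submatrix_le A j.succAbove i.succAbove
  have hle := rank_add_rank_le_card_of_mul_eq_zero
    (show A.adjugate * A = 0 by rw [adjugate_mul, hA, zero_smul])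
  have hpos : A.adjugate.rank ≠ 0 := by
    rwa [Ne, Matrix.rank, Submodule.finrank_eq_zero, LinearMap.range_eq_bot, ← toLin'_apply',
      LinearEquiv.map_eq_zero_iff]
  rw [Fintype.card_fin] at hle
  omega

theorem ne_zero_of_add_cube_eq_zero {K : Type*} [Field K] {s t : K} (h : s ^ 3 + t ^ 3 = 0)
    (hst : ¬ (s = 0 ∧ t = 0)) : s ≠ 0 ∧ t ≠ 0 := by
  constructor <;> rintro rfl <;> simp_all

theorem add_cube_eq_zero_of_mul_add_mul_eq_zero {K : Type*} [Field K] {y z v w s t : K}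
    (hyz : y ^ 3 + z ^ 3 = 0) (hvw : v ^ 3 + w ^ 3 = 0) (hy : y ≠ 0) (hw : w ≠ 0)
    (h : y * w * s + z * v * t = 0) : s ^ 3 + t ^ 3 = 0 := by
  refine (mul_eq_zero.1 ?_).resolve_left (pow_ne_zero 3 (mul_ne_zero hy hw))
  have h3 : (y * w * s) ^ 3 = (-(z * v * t)) ^ 3 := by
    rw [eq_neg_of_add_eq_zero_left h]
  linear_combination h3 - v ^ 3 * t ^ 3 * hyz + y ^ 3 * t ^ 3 * hvw

theorem moore_adjugate_rank_one_and_kernel_on_curve {K : Type*} [Field K] [IsAlgClosed K]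
    (h2 : (2 : K) ≠ 0) (h3 : (3 : K) ≠ 0)
    (l : K) (hl : l ^ 3 + 27 ≠ 0) (a b : Fin 3 → K) (ha0 : a ≠ 0) (hb0 : b ≠ 0)
    (ha : MvPolynomial.eval a (hesse l) = 0) (hb : MvPolynomial.eval b (hesse l) = 0) :
    (mooreK a b).adjugate.rank = 1 ∧
      ∀ c : Fin 3 → K, c ≠ 0 → (mooreK a b).mulVec c = 0 →
        MvPolynomial.eval c (hesse l) = 0 := by
  have hdet := det_mooreK_of_eval_hesse_eq_zero ha hb
  refine ⟨rank_adjugate_eq_one_of_fin_three hdet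
    (adjugate_mooreK_ne_zero (dbl_ne_zero hl ha0 ha) hb0), fun c hc h => ?_⟩
  obtain ⟨k0, k1, k2⟩ := (mooreK_mulVec_eq_zero_iff a b c).1 h
  -- the kernel equations are trilinear, so they also say that Moore matrices kill `a` and `iot b`
  have hdetb : (mooreK (iot b) (iot c)).det = 0 := by
    refine exists_mulVec_eq_zero_iff.1 ⟨a, ha0, (mooreK_mulVec_eq_zero_iff ..).2 ?_⟩
    simp only [iot_zero, iot_one, iot_two]
    exact ⟨by linear_combination k0, by linear_combination k1, by linear_combination k2⟩
  have hdeta : (mooreK a (iot c)).det = 0 := by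
    refine exists_mulVec_eq_zero_iff.1 ⟨iot b, iot_ne_zero hb0,
      (mooreK_mulVec_eq_zero_iff ..).2 ?_⟩
    simp only [iot_zero, iot_one, iot_two]
    exact ⟨by linear_combination k0, by linear_combination k2, by linear_combination k1⟩
  rw [det_mooreK] at hdeta hdetb
  simp only [iot_zero, iot_one, iot_two] at hdeta hdetb
  have ha1 := eq_zero_iff_fin_three.not.1 ha0
  have hb1 := eq_zero_iff_fin_three.not.1 hb0
  rw [eval_hesse] at ha hb ⊢
  by_cases hpa : a 0 * a 1 * a 2 = 0
  · by_cases hpb : b 0 * b 1 * b 2 = 0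
    · clear hdeta hdetb hdet h
      simp only [mul_eq_zero] at hpa hpb
      generalize a 0 = x, a 1 = y, a 2 = z, b 0 = u, b 1 = v, b 2 = w,
        c 0 = r, c 1 = s, c 2 = t at *
      rcases hpa with (rfl | rfl) | rfl <;> rcases hpb with (rfl | rfl) | rfl
      all_goals
        simp only [zero_mul, mul_zero, add_zero, zero_add, ne_eq, OfNat.ofNat_ne_zero,
          not_false_eq_true, zero_pow, true_and, and_true] at ha hb ha1 hb1 k0 k1 k2
        obtain ⟨p, q⟩ := ne_zero_of_add_cube_eq_zero ha ha1
        obtain ⟨p', q'⟩ := ne_zero_of_add_cube_eq_zero hb hb1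
        simp only [mul_eq_zero, p, q, p', q', or_self, false_or] at k0 k1 k2
        subst_vars
        simp only [zero_mul, mul_zero, add_zero, zero_add, ne_eq, OfNat.ofNat_ne_zero,
          not_false_eq_true, zero_pow]
        have ha' := (add_comm _ _).trans ha
        have hb' := (add_comm _ _).trans hb
        first
        | exact add_cube_eq_zero_of_mul_add_mul_eq_zero ha hb p q' (by assumption)
        | exact add_cube_eq_zero_of_mul_add_mul_eq_zero ha hb' p p' (by assumption)
        | exact add_cube_eq_zero_of_mul_add_mul_eq_zero ha' hb q q' (by assumption)
        | exact add_cube_eq_zero_of_mul_add_mul_eq_zero ha' hb' q p' (by assumption)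
    · refine (mul_eq_zero.1 ?_).resolve_left hpb
      linear_combination hdetb + c 0 * c 1 * c 2 * hb
  · refine (mul_eq_zero.1 ?_).resolve_left hpa
    linear_combination hdeta + c 0 * c 1 * c 2 * ha
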